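/- Let 0 < α < 1 and x₀ > 0. There exist θ₀ > 0 and c > 0 such that for all 0 < θ < θ₀ with cθ < 1: M_{x₀} < 2 and |R_{x₀} − (2i)^(−1) ∫_{x₀}^∞ M(y) e^(−2iφ(y)) dy| ≤ c²θ²/(1 − cθ). -/

import Mathlib

open MeasureTheory Set Filter Topology

noncomputable section

/-- The wave speed profile `c(x) = (1 + θ (x₊)^α)^(-1/2)`. -/
def spd (α θ x : ℝ) : ℝ := (1 + θ * (max x 0) ^ α) ^ (-(1 / 2) : ℝ)

/-- The WKB amplitude `b(x) = c(x)^(1/2)`. -/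
def amp (α θ x : ℝ) : ℝ := spd α θ x ^ ((1 : ℝ) / 2)

/-- The WKB phase `φ(x) = ∫₀ˣ c(y)⁻¹ dy`. -/
def phase (α θ x : ℝ) : ℝ := ∫ y in (0:ℝ)..x, (spd α θ y)⁻¹

/-- `M(x) = c(x)^(1/2) (c^(1/2))''(x)` for `x > 0`, and `0` for `x ≤ 0`. -/
def Mfun (α θ x : ℝ) : ℝ :=
  if 0 < x then
    spd α θ x ^ ((1 : ℝ) / 2) * deriv (deriv (fun y => spd α θ y ^ ((1 : ℝ) / 2))) x
  else 0

/-- `M_{x₀} = ∫_{x₀}^∞ |M(x)| dx`. -/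
def Mtail (α θ x₀ : ℝ) : ℝ := ∫ x in Ioi x₀, |Mfun α θ x|

/-- The Volterra operator `K_σ`. -/
def Kop (α θ x₀ σ : ℝ) (f : ℝ → ℂ) (x : ℝ) : ℂ :=
  (2 * Complex.I * (1 + Complex.I * (σ : ℂ)))⁻¹ *
    ((∫ y in x₀..x, (Mfun α θ y : ℂ) * f y *
        Complex.exp (-2 * Complex.I * (1 + Complex.I * (σ : ℂ)) *
          ((phase α θ x - phase α θ y : ℝ) : ℂ))) +
      ∫ y in Ioi x, (Mfun α θ y : ℂ) * f y)

/-- The right-going WKB wave `v^> = b e^{-iφ}`. -/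
def vplus (α θ x : ℝ) : ℂ := (amp α θ x : ℂ) * Complex.exp (-Complex.I * (phase α θ x : ℂ))

/-- The left-going WKB wave `v^< = b e^{iφ}`. -/
def vminus (α θ x : ℝ) : ℂ := (amp α θ x : ℂ) * Complex.exp (Complex.I * (phase α θ x : ℂ))

/-- `S` is a bounded continuous solution on `[x₀,∞)` of `S = e^{-2iφ} + K₀ S`. -/
def IsVolterraSol (α θ x₀ : ℝ) (S : ℝ → ℂ) : Prop :=
  (∃ C, ∀ x ∈ Ici x₀, ‖S x‖ ≤ C) ∧ ContinuousOn S (Ici x₀) ∧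
    ∀ x ∈ Ici x₀, S x = Complex.exp (-2 * Complex.I * (phase α θ x : ℂ)) + Kop α θ x₀ 0 S x

/-- `R_{x₀} = (2i)⁻¹ ∫_{x₀}^∞ M S^>`. -/
def Rx (α θ x₀ : ℝ) (S : ℝ → ℂ) : ℂ :=
  (2 * Complex.I)⁻¹ * ∫ x in Ioi x₀, (Mfun α θ x : ℂ) * S x

theorem hasDerivAt_one_add_mul_rpow_rpow {α θ x : ℝ} (p : ℝ) (hθ : 0 < θ) (hx : 0 < x) :
    HasDerivAt (fun y : ℝ => (1 + θ * y ^ α) ^ p)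
      (θ * (α * x ^ (α - 1)) * p * (1 + θ * x ^ α) ^ (p - 1)) x := by
  have h1 : HasDerivAt (fun y : ℝ => 1 + θ * y ^ α) (θ * (α * x ^ (α - 1))) x :=
    ((Real.hasDerivAt_rpow_const (Or.inl hx.ne')).const_mul θ).const_add 1
  have hg : 0 < 1 + θ * x ^ α := by positivity
  exact h1.rpow_const (Or.inl hg.ne')

theorem sqrt_spd_eq {α θ x : ℝ} (hθ : 0 < θ) (hx : 0 < x) :
    spd α θ x ^ ((1 : ℝ) / 2) = (1 + θ * x ^ α) ^ (-(1 / 4) : ℝ) := by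
  have hg : 0 ≤ 1 + θ * x ^ α := by positivity
  rw [spd, max_eq_left hx.le, ← Real.rpow_mul hg]
  norm_num

theorem Mfun_eq {α θ x : ℝ} (hθ : 0 < θ) (hx : 0 < x) :
    Mfun α θ x = (1 + θ * x ^ α) ^ (-(1 / 4) : ℝ) *
      (θ * (α * ((α - 1) * x ^ (α - 2))) * (-(1 / 4)) * (1 + θ * x ^ α) ^ (-(5 / 4) : ℝ) +
        θ * (α * x ^ (α - 1)) * (-(1 / 4)) *
          (θ * (α * x ^ (α - 1)) * (-(5 / 4)) * (1 + θ * x ^ α) ^ (-(9 / 4) : ℝ))) := by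
  rw [Mfun, if_pos hx, sqrt_spd_eq hθ hx]
  congr 1
  have hd : ∀ y : ℝ, 0 < y → deriv (fun y => spd α θ y ^ ((1 : ℝ) / 2)) y =
      θ * (α * y ^ (α - 1)) * (-(1 / 4)) * (1 + θ * y ^ α) ^ (-(5 / 4) : ℝ) := by
    intro y hy
    have heq : (fun y => spd α θ y ^ ((1 : ℝ) / 2)) =ᶠ[𝓝 y]
        fun y => (1 + θ * y ^ α) ^ (-(1 / 4) : ℝ) := by
      filter_upwards [Ioi_mem_nhds hy] with z hz using sqrt_spd_eq hθ hz
    rw [heq.deriv_eq, (hasDerivAt_one_add_mul_rpow_rpow _ hθ hy).deriv]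
    norm_num
  have heq : deriv (fun y => spd α θ y ^ ((1 : ℝ) / 2)) =ᶠ[𝓝 x]
      fun y => θ * (α * y ^ (α - 1)) * (-(1 / 4)) * (1 + θ * y ^ α) ^ (-(5 / 4) : ℝ) := by
    filter_upwards [Ioi_mem_nhds hx] with z hz using hd z hz
  rw [heq.deriv_eq]
  have h1 : HasDerivAt (fun y : ℝ => y ^ (α - 1)) ((α - 1) * x ^ (α - 1 - 1)) x :=
    Real.hasDerivAt_rpow_const (Or.inl hx.ne')
  have h2 := (((h1.const_mul α).const_mul θ).mul_const (-(1 / 4) : ℝ)).mul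
    (hasDerivAt_one_add_mul_rpow_rpow (α := α) (-(5 / 4) : ℝ) hθ hx)
  refine h2.deriv.trans ?_
  norm_num [sub_sub]

theorem abs_Mfun_le {α θ x : ℝ} (hα0 : 0 < α) (hα1 : α < 1) (hθ : 0 < θ) (hx : 0 < x) :
    |Mfun α θ x| ≤ θ * x ^ (α - 2) := by
  have ht : 0 < θ * x ^ α := by positivity
  have hg : 0 < 1 + θ * x ^ α := by positivity
  have hsq : x ^ (α - 1) * x ^ (α - 1) = x ^ (α - 2) * x ^ α := by
    rw [← Real.rpow_add hx, ← Real.rpow_add hx]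
    ring_nf
  have h1 : (1 + θ * x ^ α) ^ (-(1 / 4) : ℝ) * (1 + θ * x ^ α) ^ (-(5 / 4) : ℝ) ≤ 1 := by
    rw [← Real.rpow_add hg]
    exact Real.rpow_le_one_of_one_le_of_nonpos (by linarith) (by norm_num)
  have h2 : (1 + θ * x ^ α) ^ (-(1 / 4) : ℝ) * (1 + θ * x ^ α) ^ (-(9 / 4) : ℝ) * (θ * x ^ α)
      ≤ 1 := by
    calc _ ≤ (1 + θ * x ^ α) ^ (-(1 / 4) : ℝ) * (1 + θ * x ^ α) ^ (-(9 / 4) : ℝ) *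
          (1 + θ * x ^ α) ^ (1 : ℝ) := by
          rw [Real.rpow_one]
          gcongr
          linarith
      _ ≤ 1 := by
          rw [← Real.rpow_add hg, ← Real.rpow_add hg]
          exact Real.rpow_le_one_of_one_le_of_nonpos (by linarith) (by norm_num)
  have hM : Mfun α θ x = θ * x ^ (α - 2) *
      (α * (1 - α) / 4 *
          ((1 + θ * x ^ α) ^ (-(1 / 4) : ℝ) * (1 + θ * x ^ α) ^ (-(5 / 4) : ℝ)) +
        5 * α ^ 2 / 16 * ((1 + θ * x ^ α) ^ (-(1 / 4) : ℝ) *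
          (1 + θ * x ^ α) ^ (-(9 / 4) : ℝ) * (θ * x ^ α))) := by
    rw [Mfun_eq hθ hx]
    linear_combination (5 * α ^ 2 / 16 * θ ^ 2 * (1 + θ * x ^ α) ^ (-(1 / 4) : ℝ) *
          (1 + θ * x ^ α) ^ (-(9 / 4) : ℝ)) * hsq
  have hα : 0 < 1 - α := by linarith
  rw [hM, abs_of_nonneg (by positivity)]
  refine mul_le_of_le_one_right (by positivity) ?_
  have h3 := mul_le_of_le_one_right (a := α * (1 - α) / 4) (by positivity) h1
  have h4 := mul_le_of_le_one_right (a := 5 * α ^ 2 / 16) (by positivity) h2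
  nlinarith

theorem integral_Ioi_mul_rpow {α θ x₀ : ℝ} (hα1 : α < 1) (hx₀ : 0 < x₀) :
    ∫ y in Ioi x₀, θ * y ^ (α - 2) = θ * (x₀ ^ (α - 1) / (1 - α)) := by
  rw [integral_const_mul, integral_Ioi_rpow_of_lt (by linarith) hx₀,
    show α - 2 + 1 = -(1 - α) by ring, neg_div_neg_eq, neg_sub]

theorem integrableOn_Ioi_mul_rpow {α θ x₀ : ℝ} (hα1 : α < 1) (hx₀ : 0 < x₀) :
    IntegrableOn (fun y : ℝ => θ * y ^ (α - 2)) (Ioi x₀) :=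
  (integrableOn_Ioi_rpow_of_lt (by linarith) hx₀).const_mul θ

theorem continuousOn_Mfun {α θ : ℝ} (hθ : 0 < θ) : ContinuousOn (Mfun α θ) (Ioi 0) := by
  refine ContinuousOn.congr (f := fun x => (1 + θ * x ^ α) ^ (-(1 / 4) : ℝ) *
      (θ * (α * ((α - 1) * x ^ (α - 2))) * (-(1 / 4)) * (1 + θ * x ^ α) ^ (-(5 / 4) : ℝ) +
        θ * (α * x ^ (α - 1)) * (-(1 / 4)) *
          (θ * (α * x ^ (α - 1)) * (-(5 / 4)) * (1 + θ * x ^ α) ^ (-(9 / 4) : ℝ)))) ?_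
    fun x hx => Mfun_eq hθ hx
  have hr : ∀ p : ℝ, ContinuousOn (fun x : ℝ => x ^ p) (Ioi 0) := fun p =>
    continuousOn_id.rpow_const fun x hx => Or.inl (ne_of_gt hx)
  have hg : ∀ p : ℝ, ContinuousOn (fun x : ℝ => (1 + θ * x ^ α) ^ p) (Ioi 0) := fun p =>
    (continuousOn_const.add (continuousOn_const.mul (hr α))).rpow_const fun x hx => by
      have hx' : (0 : ℝ) < x := hx
      have hpos : 0 < 1 + θ * x ^ α := by positivity
      exact Or.inl hpos.ne'
  have h1 := hr (α - 1)
  have h2 := hr (α - 2)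
  have h3 := hg (-(1 / 4))
  have h4 := hg (-(5 / 4))
  have h5 := hg (-(9 / 4))
  fun_prop

theorem continuous_phase {α θ : ℝ} (hα0 : 0 < α) (hθ : 0 < θ) : Continuous (phase α θ) := by
  have hpos : ∀ y : ℝ, 0 < 1 + θ * (max y 0) ^ α := fun y => by positivity
  have hs : Continuous (spd α θ) :=
    Continuous.rpow_const
      (continuous_const.add (continuous_const.mul
        ((continuous_id.max continuous_const).rpow_const fun _ => Or.inr hα0.le)))
      fun y => Or.inl (hpos y).ne'
  have hi : Continuous fun y => (spd α θ y)⁻¹ :=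
    hs.inv₀ fun y => (Real.rpow_pos_of_pos (hpos y) _).ne'
  exact intervalIntegral.continuous_primitive (fun a b => hi.intervalIntegrable a b) 0

theorem norm_exp_neg_two_I_mul (r : ℝ) : ‖Complex.exp (-2 * Complex.I * (r : ℂ))‖ = 1 := by
  rw [show -2 * Complex.I * (r : ℂ) = ((-2 * r : ℝ) : ℂ) * Complex.I by push_cast; ring]
  exact Complex.norm_exp_ofReal_mul_I _

theorem norm_inv_two_I : ‖(2 * Complex.I)⁻¹‖ = 1 / 2 := by
  simp

theorem integrableOn_Mfun_mul {α θ x₀ B : ℝ} {f : ℝ → ℂ} (hα0 : 0 < α) (hα1 : α < 1)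
    (hθ : 0 < θ) (hx₀ : 0 < x₀) (hf : ContinuousOn f (Ioi x₀)) (hB : ∀ x ∈ Ioi x₀, ‖f x‖ ≤ B) :
    IntegrableOn (fun y => (Mfun α θ y : ℂ) * f y) (Ioi x₀) := by
  refine Integrable.mono' ((integrableOn_Ioi_mul_rpow (θ := θ) hα1 hx₀).mul_const B) ?_ ?_
  · refine ContinuousOn.aestronglyMeasurable ?_ measurableSet_Ioi
    refine ContinuousOn.mul ?_ hf
    exact Complex.continuous_ofReal.comp_continuousOn
      ((continuousOn_Mfun hθ).mono (Ioi_subset_Ioi hx₀.le))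
  · refine (ae_restrict_iff' measurableSet_Ioi).2 (ae_of_all _ fun y hy => ?_)
    have hy0 : 0 < y := hx₀.trans hy
    rw [norm_mul, Complex.norm_real, Real.norm_eq_abs]
    exact mul_le_mul (abs_Mfun_le hα0 hα1 hθ hy0) (hB y hy) (norm_nonneg _) (by positivity)

theorem norm_Kop_zero_le {α θ x₀ B x : ℝ} {f : ℝ → ℂ} (hα0 : 0 < α) (hα1 : α < 1)
    (hθ : 0 < θ) (hx₀ : 0 < x₀) (hB : ∀ x ∈ Ici x₀, ‖f x‖ ≤ B) (hx : x₀ ≤ x) :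
    ‖Kop α θ x₀ 0 f x‖ ≤ x₀ ^ (α - 1) / (1 - α) / 2 * θ * B := by
  have hint : IntegrableOn (fun y => θ * y ^ (α - 2) * B) (Ioi x₀) :=
    (integrableOn_Ioi_mul_rpow hα1 hx₀).mul_const B
  have hMf : ∀ y, x₀ < y → ‖(Mfun α θ y : ℂ) * f y‖ ≤ θ * y ^ (α - 2) * B := by
    intro y hy
    have hy0 : 0 < y := hx₀.trans hy
    rw [norm_mul, Complex.norm_real, Real.norm_eq_abs]
    exact mul_le_mul (abs_Mfun_le hα0 hα1 hθ hy0) (hB y hy.le) (norm_nonneg _) (by positivity)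
  have h1 : ‖∫ y in x₀..x, (Mfun α θ y : ℂ) * f y *
        Complex.exp (-2 * Complex.I * ((phase α θ x - phase α θ y : ℝ) : ℂ))‖ ≤
      ∫ y in x₀..x, θ * y ^ (α - 2) * B := by
    refine intervalIntegral.norm_integral_le_of_norm_le hx (ae_of_all _ fun y hy => ?_) ?_
    · rw [norm_mul, norm_exp_neg_two_I_mul, mul_one]
      exact hMf y hy.1
    · rw [intervalIntegrable_iff_integrableOn_Ioc_of_le hx]
      exact hint.mono_set Ioc_subset_Ioi_self
  have h2 : ‖∫ y in Ioi x, (Mfun α θ y : ℂ) * f y‖ ≤ ∫ y in Ioi x, θ * y ^ (α - 2) * B := by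
    refine norm_integral_le_of_norm_le (hint.mono_set (Ioi_subset_Ioi hx)) ?_
    exact (ae_restrict_iff' measurableSet_Ioi).2
      (ae_of_all _ fun y hy => hMf y (lt_of_le_of_lt hx hy))
  have h3 : (∫ y in x₀..x, θ * y ^ (α - 2) * B) + ∫ y in Ioi x, θ * y ^ (α - 2) * B =
      θ * (x₀ ^ (α - 1) / (1 - α)) * B := by
    rw [intervalIntegral.integral_interval_add_Ioi hint (hint.mono_set (Ioi_subset_Ioi hx)),
      integral_mul_const, integral_Ioi_mul_rpow hα1 hx₀]
  rw [Kop]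
  simp only [Complex.ofReal_zero, mul_zero, add_zero, mul_one]
  rw [norm_mul, norm_inv_two_I]
  have h4 := norm_add_le (∫ y in x₀..x, (Mfun α θ y : ℂ) * f y *
        Complex.exp (-2 * Complex.I * ((phase α θ x - phase α θ y : ℝ) : ℂ)))
    (∫ y in Ioi x, (Mfun α θ y : ℂ) * f y)
  linarith

theorem IsVolterraSol.norm_le {α θ x₀ : ℝ} {S : ℝ → ℂ} (hα0 : 0 < α) (hα1 : α < 1)
    (hθ : 0 < θ) (hx₀ : 0 < x₀) (hsmall : x₀ ^ (α - 1) / (1 - α) / 2 * θ < 1)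
    (hS : IsVolterraSol α θ x₀ S) :
    ∀ x ∈ Ici x₀, ‖S x‖ ≤ 1 / (1 - x₀ ^ (α - 1) / (1 - α) / 2 * θ) := by
  obtain ⟨⟨D, hD⟩, -, heq⟩ := hS
  have hbdd : BddAbove ((fun x => ‖S x‖) '' Ici x₀) := ⟨D, by rintro _ ⟨x, hx, rfl⟩; exact hD x hx⟩
  set B := sSup ((fun x => ‖S x‖) '' Ici x₀)
  have hB : ∀ x ∈ Ici x₀, ‖S x‖ ≤ B := fun x hx => le_csSup hbdd ⟨x, hx, rfl⟩
  have hle : B ≤ 1 + x₀ ^ (α - 1) / (1 - α) / 2 * θ * B := by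
    refine csSup_le ⟨_, x₀, self_mem_Ici, rfl⟩ ?_
    rintro _ ⟨x, hx, rfl⟩
    calc ‖S x‖ ≤ ‖Complex.exp (-2 * Complex.I * (phase α θ x : ℂ))‖ + ‖Kop α θ x₀ 0 S x‖ := by
          conv_lhs => rw [heq x hx]
          exact norm_add_le _ _
      _ ≤ _ := by
          rw [norm_exp_neg_two_I_mul]
          gcongr
          exact norm_Kop_zero_le hα0 hα1 hθ hx₀ hB hx
  intro x hx
  refine (hB x hx).trans ?_
  rw [le_div_iff₀ (by linarith)]
  linarith

/-- first-order approximation of `R_{x₀}` for `0 < α < 1`. -/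
theorem stmt9 (α x₀ : ℝ) (hα0 : 0 < α) (hα1 : α < 1) (hx₀ : 0 < x₀) :
    ∃ θ₀ > (0:ℝ), ∃ C > (0:ℝ), ∀ θ : ℝ, 0 < θ → θ < θ₀ → C * θ < 1 →
      Mtail α θ x₀ < 2 ∧
      ∀ S : ℝ → ℂ, IsVolterraSol α θ x₀ S →
        ‖Rx α θ x₀ S -
            (2 * Complex.I)⁻¹ *
              ∫ y in Ioi x₀, (Mfun α θ y : ℂ) *
                Complex.exp (-2 * Complex.I * (phase α θ y : ℂ))‖ ≤
          C ^ 2 * θ ^ 2 / (1 - C * θ) := by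
  have hα : 0 < 1 - α := by linarith
  have hC : 0 < x₀ ^ (α - 1) / (1 - α) / 2 := by positivity
  refine ⟨1, one_pos, x₀ ^ (α - 1) / (1 - α) / 2, hC, fun θ hθ _ hsmall => ⟨?_, fun S hS => ?_⟩⟩
  · have h := norm_integral_le_of_norm_le (f := fun x => |Mfun α θ x|)
      (integrableOn_Ioi_mul_rpow (θ := θ) hα1 hx₀) ((ae_restrict_iff' measurableSet_Ioi).2
        (ae_of_all _ fun y hy => by
          rw [Real.norm_eq_abs, abs_abs]
          exact abs_Mfun_le hα0 hα1 hθ (hx₀.trans hy)))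
    rw [integral_Ioi_mul_rpow hα1 hx₀] at h
    have h' := (le_abs_self (Mtail α θ x₀)).trans h
    linarith
  · have hSB := hS.norm_le hα0 hα1 hθ hx₀ hsmall
    obtain ⟨-, hcont, heq⟩ := hS
    have hcexp : Continuous fun y => Complex.exp (-2 * Complex.I * (phase α θ y : ℂ)) := by
      have := continuous_phase hα0 hθ
      fun_prop
    rw [Rx, ← mul_sub, ← integral_sub
      (integrableOn_Mfun_mul hα0 hα1 hθ hx₀ (hcont.mono Ioi_subset_Ici_self)
        fun x hx => hSB x (Ioi_subset_Ici_self hx))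
      (integrableOn_Mfun_mul hα0 hα1 hθ hx₀ hcexp.continuousOn
        fun x _ => (norm_exp_neg_two_I_mul _).le), norm_mul, norm_inv_two_I]
    set C := x₀ ^ (α - 1) / (1 - α) / 2 with hCdef
    have hdiff : ∀ y ∈ Ioi x₀, ‖(Mfun α θ y : ℂ) * S y -
        (Mfun α θ y : ℂ) * Complex.exp (-2 * Complex.I * (phase α θ y : ℂ))‖ ≤
        θ * y ^ (α - 2) * (C * θ * (1 / (1 - C * θ))) := by
      intro y hy
      have hy0 : 0 < y := hx₀.trans hy
      have hy' : y ∈ Ici x₀ := Ioi_subset_Ici_self hy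
      rw [← mul_sub, sub_eq_of_eq_add' (heq y hy'), norm_mul, Complex.norm_real,
        Real.norm_eq_abs]
      exact mul_le_mul (abs_Mfun_le hα0 hα1 hθ hy0)
        (norm_Kop_zero_le hα0 hα1 hθ hx₀ hSB hy') (norm_nonneg _) (by positivity)
    have h := norm_integral_le_of_norm_le
      ((integrableOn_Ioi_mul_rpow (θ := θ) hα1 hx₀).mul_const (C * θ * (1 / (1 - C * θ))))
      ((ae_restrict_iff' measurableSet_Ioi).2 (ae_of_all _ hdiff))
    rw [integral_mul_const, integral_Ioi_mul_rpow hα1 hx₀,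
      show x₀ ^ (α - 1) / (1 - α) = 2 * C by rw [hCdef]; ring] at h
    calc _ ≤ 1 / 2 * (θ * (2 * C) * (C * θ * (1 / (1 - C * θ)))) := by gcongr
      _ = _ := by ring
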